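/- arXiv:1811.05870 — 2 statements merged into one kernel-verified Lean document; each statement's English description precedes it below -/
import Mathlib

section
/- Let F be a field, G an abelian group, and U = UT(n_1,…,n_s) ⊆ M_n(F). If two G-gradings Γ_1 and Γ_2 on the associative algebra U are both in canonical form and are isomorphic to one another, then there exists an invertible block-diagonal matrix x ∈ U such that Int(x): y ↦ xyx^{-1} is an isomorphism from Γ_1 to Γ_2. -/
open Matrix
set_option synthInstance.maxHeartbeats 1000000
set_option maxHeartbeats 1000000

structure AlgGrading (F : Type*) [CommRing F] (A : Type*) [Ring A] [Algebra F A]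
    (G : Type*) [Group G] where
  comp : G → Submodule F A
  indep : ∀ g : G, Disjoint (comp g) (⨆ h : G, ⨆ _ : h ≠ g, comp h)
  total : (⨆ g : G, comp g) = ⊤
  mul_mem : ∀ g h : G, ∀ x ∈ comp g, ∀ y ∈ comp h, x * y ∈ comp (g * h)

structure LieGrading (F : Type*) [CommRing F] (L : Type*) [LieRing L] [LieAlgebra F L]
    (G : Type*) [Group G] where
  comp : G → Submodule F L
  indep : ∀ g : G, Disjoint (comp g) (⨆ h : G, ⨆ _ : h ≠ g, comp h)
  total : (⨆ g : G, comp g) = ⊤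
  lie_mem : ∀ g h : G, ∀ x ∈ comp g, ∀ y ∈ comp h, ⁅x, y⁆ ∈ comp (g * h)

variable (F : Type*) [Field F] {n s : ℕ}

def UTB (b : Fin n → Fin s) : Subalgebra F (Matrix (Fin n) (Fin n) F) where
  carrier := {M | M.BlockTriangular b}
  mul_mem' := fun {M N} hM hN => hM.mul hN
  add_mem' := fun {M N} hM hN => hM.add hN
  algebraMap_mem' := fun c => by
    show (algebraMap F (Matrix (Fin n) (Fin n) F) c).BlockTriangular b
    rw [Matrix.algebraMap_eq_diagonal]
    exact Matrix.blockTriangular_diagonal _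

def Jdiag (b : Fin n → Fin s) (m : ℤ) : Submodule F (Matrix (Fin n) (Fin n) F) where
  carrier := {M | ∀ p q : Fin n, ((b q : ℤ) ≠ (b p : ℤ) + m) → M p q = 0}
  add_mem' := fun {M N} hM hN p q h => by
    simp [Matrix.add_apply, hM p q h, hN p q h]
  zero_mem' := fun p q h => rfl
  smul_mem' := fun c M hM p q h => by
    simp [Matrix.smul_apply, hM p q h]

def AlgGrading.IsGradedSubspace {F : Type*} [CommRing F] {A : Type*} [Ring A] [Algebra F A]
    {G : Type*} [Group G] (Γ : AlgGrading F A G) (V : Submodule F A) : Prop :=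
  V = ⨆ g : G, V ⊓ Γ.comp g

def LieGrading.IsGradedSubspace {F : Type*} [CommRing F] {L : Type*} [LieRing L]
    [LieAlgebra F L] {G : Type*} [Group G] (Γ : LieGrading F L G) (V : Submodule F L) : Prop :=
  V = ⨆ g : G, V ⊓ Γ.comp g

def AlgGrading.Iso {F : Type*} [CommRing F] {A : Type*} [Ring A] [Algebra F A]
    {G : Type*} [Group G] (Γ₁ Γ₂ : AlgGrading F A G) : Prop :=
  ∃ ψ : A ≃ₐ[F] A, ∀ g : G, (Γ₁.comp g).map ψ.toLinearMap = Γ₂.comp g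

def LieGrading.Iso {F : Type*} [CommRing F] {L : Type*} [LieRing L] [LieAlgebra F L]
    {G : Type*} [Group G] (Γ₁ Γ₂ : LieGrading F L G) : Prop :=
  ∃ ψ : L ≃ₗ⁅F⁆ L, ∀ g : G, (Γ₁.comp g).map ψ.toLinearEquiv.toLinearMap = Γ₂.comp g

/-- The block superdiagonal `J_m`, viewed as a subspace of `U = UT(n₁,…,n_s)`. -/
def JdiagU (b : Fin n → Fin s) (m : ℤ) : Submodule F ↥(UTB F b) :=
  (Jdiag F b m).comap (UTB F b).val.toLinearMap


/-- Conjugation `y ↦ x y x⁻¹` by a unit, as a linear map. -/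
def conjMap {F : Type*} [CommRing F] {A : Type*} [Ring A] [Algebra F A] (x : Aˣ) :
    A →ₗ[F] A where
  toFun y := ↑x * y * ↑x⁻¹
  map_add' y z := by simp [add_mul, mul_add]
  map_smul' c y := by simp [Algebra.mul_smul_comm, Algebra.smul_mul_assoc]

/-- Every homogeneous component of a grading is the range of a homogeneous projection. -/
theorem AlgGrading.exists_projection {F : Type*} [CommRing F] {A : Type*} [Ring A] [Algebra F A]
    {G : Type*} [Group G] (Γ : AlgGrading F A G) (g : G) :
    ∃ π : A →ₗ[F] A, (∀ a, π a ∈ Γ.comp g) ∧ (∀ a ∈ Γ.comp g, π a = a) ∧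
      ∀ h, h ≠ g → ∀ a ∈ Γ.comp h, π a = 0 := by
  have hc : IsCompl (Γ.comp g) (⨆ h : G, ⨆ _ : h ≠ g, Γ.comp h) := by
    refine ⟨Γ.indep g, codisjoint_iff_le_sup.2 ?_⟩
    rw [← Γ.total]
    refine iSup_le fun h => ?_
    by_cases hg : h = g
    · exact hg ▸ le_sup_left
    · exact le_sup_of_le_right (le_iSup₂_of_le h hg le_rfl)
  refine ⟨(Γ.comp g).subtype ∘ₗ Submodule.projectionOnto _ _ hc, fun a => ?_, fun a ha => ?_,
    fun h hg a ha => ?_⟩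
  · exact Subtype.property _
  · exact congrArg Subtype.val (Submodule.projectionOnto_apply_left hc ⟨a, ha⟩)
  · have : a ∈ ⨆ h : G, ⨆ _ : h ≠ g, Γ.comp h :=
      (le_iSup₂_of_le (f := fun h (_ : h ≠ g) => Γ.comp h) h hg le_rfl) ha
    exact congrArg Subtype.val (Submodule.projectionOnto_apply_right hc ⟨a, this⟩)

/-- A homogeneous projection maps every graded subspace to itself. -/
theorem AlgGrading.IsGradedSubspace.projection_mem {F : Type*} [CommRing F] {A : Type*} [Ring A]
    [Algebra F A] {G : Type*} [Group G] {Γ : AlgGrading F A G} {V : Submodule F A}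
    (hV : Γ.IsGradedSubspace V) {g : G} {π : A →ₗ[F] A} (h1 : ∀ a ∈ Γ.comp g, π a = a)
    (h0 : ∀ h, h ≠ g → ∀ a ∈ Γ.comp h, π a = 0) {a : A} (ha : a ∈ V) : π a ∈ V := by
  suffices V ≤ V.comap π from this ha
  conv_lhs => rw [hV]
  refine iSup_le fun h a ha => ?_
  by_cases hg : h = g
  · subst hg
    simpa [h1 a ha.2] using ha.1
  · simp [h0 h hg a ha.2]

section BlockPart

variable {F} (b : Fin n → Fin s)

/-- The projection of `U` onto its `m`-th block superdiagonal. -/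
def blockPart (m : ℕ) : UTB F b →ₗ[F] UTB F b where
  toFun M := ⟨Matrix.of fun p q => if (b q : ℕ) = b p + m then M.1 p q else 0, fun p q h => by
    have : (b q : ℕ) < b p := h
    exact if_neg (by omega)⟩
  map_add' M N := by
    ext p q
    by_cases h : (b q : ℕ) = b p + m <;> simp [h]
  map_smul' c M := by
    ext p q
    by_cases h : (b q : ℕ) = b p + m <;> simp [h]

theorem blockPart_apply (m : ℕ) (M : UTB F b) (p q : Fin n) :
    (blockPart b m M).1 p q = if (b q : ℕ) = b p + m then M.1 p q else 0 := rfl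

theorem mem_JdiagU {m : ℕ} {M : UTB F b} :
    M ∈ JdiagU F b m ↔ ∀ p q, (b q : ℕ) ≠ b p + m → M.1 p q = 0 := by
  refine forall₂_congr fun p q => ?_
  norm_cast

theorem UTB.apply_eq_zero (M : UTB F b) {p q : Fin n} (h : (b q : ℕ) < b p) : M.1 p q = 0 :=
  M.2 h

theorem blockPart_mem (m : ℕ) (M : UTB F b) : blockPart b m M ∈ JdiagU F b m :=
  (mem_JdiagU b).2 fun _ _ h => if_neg h

theorem blockPart_of_mem {m : ℕ} {M : UTB F b} (h : M ∈ JdiagU F b m) (k : ℕ) :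
    blockPart b k M = if k = m then M else 0 := by
  rw [mem_JdiagU] at h
  ext p q
  rw [blockPart_apply]
  split_ifs with h1 h2 h2
  · rfl
  · exact h p q (by omega)
  · exact (h p q (by omega)).symm
  · rfl

theorem sum_blockPart (M : UTB F b) : ∑ m ∈ Finset.range s, blockPart b m M = M := by
  ext p q
  have hs : (∑ m ∈ Finset.range s, blockPart b m M).1 p q =
      ∑ m ∈ Finset.range s, (blockPart b m M).1 p q := by
    rw [AddSubmonoidClass.coe_finsetSum, Matrix.sum_apply]
  rw [hs]
  by_cases h : (b q : ℕ) < b p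
  · rw [UTB.apply_eq_zero b M h]
    exact Finset.sum_eq_zero fun m _ => UTB.apply_eq_zero b _ h
  · rw [Finset.sum_eq_single ((b q : ℕ) - b p)]
    · rw [blockPart_apply, if_pos (by omega)]
    · intro m _ hm
      rw [blockPart_apply, if_neg (by omega)]
    · intro hm
      exact absurd (Finset.mem_range.2 (by have := (b q).2; omega)) hm

theorem blockPart_mul_mul {m : ℕ} {a : UTB F b} (ha : a ∈ JdiagU F b m) (y z : UTB F b) :
    blockPart b m (y * a * z) = blockPart b 0 y * a * blockPart b 0 z := by
  rw [mem_JdiagU] at ha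
  ext p q
  rw [blockPart_apply]
  simp only [MulMemClass.coe_mul, Matrix.mul_apply, Finset.sum_mul, blockPart_apply]
  by_cases hpq : (b q : ℕ) = b p + m
  · rw [if_pos hpq]
    refine Finset.sum_congr rfl fun j _ => Finset.sum_congr rfl fun i _ => ?_
    by_cases hij : (b j : ℕ) = b i + m
    · rcases lt_trichotomy (b i : ℕ) (b p) with h | h | h
      · simp [UTB.apply_eq_zero b y h]
      · rw [if_pos (by omega), if_pos (by omega)]
      · rw [UTB.apply_eq_zero b z (p := j) (q := q) (by omega)]
        simp
    · simp [ha i j hij]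
  · rw [if_neg hpq]
    refine (Finset.sum_eq_zero fun j _ => Finset.sum_eq_zero fun i _ => ?_).symm
    by_cases hij : (b j : ℕ) = b i + m
    · by_cases hi : (b i : ℕ) = b p + 0
      · rw [if_neg (c := (b q : ℕ) = b j + 0) (by omega), mul_zero]
      · rw [if_neg hi, zero_mul, zero_mul]
    · rw [ha i j hij, mul_zero, zero_mul]

theorem blockPart_zero_one : blockPart b 0 (1 : UTB F b) = 1 := by
  refine (blockPart_of_mem b (m := 0) ((mem_JdiagU b).2 fun p q h => ?_) 0).trans (if_pos rfl)
  exact Matrix.one_apply_ne fun hpq => h (by simp [hpq])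

theorem blockPart_zero_mul (y z : UTB F b) :
    blockPart b 0 (y * z) = blockPart b 0 y * blockPart b 0 z := by
  have h := blockPart_mul_mul b (m := 0) (a := blockPart b 0 1) (blockPart_mem b 0 1) y z
  simpa [blockPart_zero_one] using h

/-- The block-diagonal part of an invertible element of `U`. -/
def blockDiagUnit (y : (UTB F b)ˣ) : (UTB F b)ˣ where
  val := blockPart b 0 y
  inv := blockPart b 0 ↑y⁻¹
  val_inv := by rw [← blockPart_zero_mul, Units.mul_inv, blockPart_zero_one]
  inv_val := by rw [← blockPart_zero_mul, Units.inv_mul, blockPart_zero_one]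

theorem blockPart_mem_comp {G : Type*} [Group G] (Γ : AlgGrading F (UTB F b) G)
    (hc : ∀ m : ℕ, m < s → Γ.IsGradedSubspace (JdiagU F b m)) {g : G} {a : UTB F b}
    (ha : a ∈ Γ.comp g) {m : ℕ} (hm : m < s) : blockPart b m a ∈ Γ.comp g := by
  obtain ⟨π, hπ, h1, h0⟩ := Γ.exists_projection g
  have key : blockPart b m (π a) = π (blockPart b m a) := by
    conv_lhs => rw [← sum_blockPart b a, map_sum, map_sum]
    rw [Finset.sum_eq_single m]
    · rw [blockPart_of_mem b ((hc m hm).projection_mem h1 h0 (blockPart_mem b m a)), if_pos rfl]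
    · intro k hk hkm
      rw [blockPart_of_mem b ((hc k (Finset.mem_range.1 hk)).projection_mem h1 h0
        (blockPart_mem b k a)), if_neg hkm.symm]
    · exact fun h => absurd (Finset.mem_range.2 hm) h
  rw [← h1 a ha, key]
  exact hπ _

theorem blockDiagUnit_conj_mem {G : Type*} [Group G] {Γ₁ Γ₂ : AlgGrading F (UTB F b) G}
    (hc₁ : ∀ m : ℕ, m < s → Γ₁.IsGradedSubspace (JdiagU F b m))
    (hc₂ : ∀ m : ℕ, m < s → Γ₂.IsGradedSubspace (JdiagU F b m)) {y : (UTB F b)ˣ} {g : G}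
    (h : ∀ a ∈ Γ₁.comp g, ↑y * a * ↑y⁻¹ ∈ Γ₂.comp g) {a : UTB F b} (ha : a ∈ Γ₁.comp g) :
    ↑(blockDiagUnit b y) * a * ↑(blockDiagUnit b y)⁻¹ ∈ Γ₂.comp g := by
  rw [← sum_blockPart b a, Finset.mul_sum, Finset.sum_mul]
  refine sum_mem fun m hm => ?_
  have hm := Finset.mem_range.1 hm
  have h2 := blockPart_mem_comp b Γ₂ hc₂ (h _ (blockPart_mem_comp b Γ₁ hc₁ ha hm)) hm
  rwa [blockPart_mul_mul b (blockPart_mem b m a)] at h2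

end BlockPart

section Inner

variable {F} (b : Fin n → Fin s)

/-- The matrix unit `E_{ij}` scaled by `c`, as an element of `U`. -/
def UTB.single {i j : Fin n} (h : b i ≤ b j) (c : F) : UTB F b :=
  ⟨Matrix.single i j c, fun p q hpq => by
    refine Matrix.single_apply_of_ne _ _ _ _ _ ?_
    rintro ⟨rfl, rfl⟩
    exact absurd hpq (not_lt.2 h)⟩

/-- The member of the standard flag cut out by block index `i`. -/
def blockFlag (F : Type*) [Field F] {n s : ℕ} (b : Fin n → Fin s) (i : Fin s) :
    Submodule F (Fin n → F) where
  carrier := {w | ∀ p, i < b p → w p = 0}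
  add_mem' hv hw p hp := by simp [hv p hp, hw p hp]
  zero_mem' _ _ := rfl
  smul_mem' c w hw p hp := by simp [hw p hp]

/-- A matrix intertwining an automorphism of the block triangular algebra with
the identity is itself block triangular. -/
theorem blockTriangular_of_intertwines {ψ : UTB F b ≃ₐ[F] UTB F b}
    {T : Matrix (Fin n) (Fin n) F} (hT : ∀ M : UTB F b, T * M.1 = (ψ M).1 * T) :
    T.BlockTriangular b := by
  intro p q hpq
  by_contra hne
  have hle : blockFlag F b (b p) ≤ (blockFlag F b (b q)).map T.mulVecLin := by
    intro w hw
    let C : UTB F b := ⟨Matrix.vecMulVec w (Pi.single p (T p q)⁻¹), fun i j hij => by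
      rw [Matrix.vecMulVec_apply]
      by_cases hj : j = p
      · subst hj
        rw [hw i hij, zero_mul]
      · simp [hj]⟩
    refine ⟨(ψ.symm C).1 *ᵥ Pi.single q 1, fun i hi => ?_, ?_⟩
    · rw [Matrix.mulVec_single_one]
      exact (ψ.symm C).2 hi
    · have h1 := hT (ψ.symm C)
      rw [AlgEquiv.apply_symm_apply] at h1
      rw [Matrix.mulVecLin_apply, Matrix.mulVec_mulVec, h1, ← Matrix.mulVec_mulVec,
        Matrix.mulVec_single_one, Matrix.vecMulVec_mulVec]
      ext i
      simp [hne]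
  have hlt : blockFlag F b (b q) < blockFlag F b (b p) := by
    refine lt_of_le_of_ne (fun w hw i hi => hw i (hpq.trans hi)) fun h => ?_
    have hp : (Pi.single p 1 : Fin n → F) ∈ blockFlag F b (b p) := fun i hi =>
      Pi.single_eq_of_ne (fun hip => absurd hi (by simp [hip])) _
    rw [← h] at hp
    simpa using hp p hpq
  exact absurd (Submodule.finrank_lt_finrank_of_lt hlt)
    (not_lt.2 ((Submodule.finrank_mono hle).trans (Submodule.finrank_map_le _ _)))

/-- Every automorphism of a block triangular matrix algebra is inner. -/
theorem UTB.exists_conj (hb : Monotone b) (ψ : UTB F b ≃ₐ[F] UTB F b) :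
    ∃ y : (UTB F b)ˣ, ∀ M, ψ M = ↑y * M * ↑y⁻¹ := by
  rcases Nat.eq_zero_or_pos n with rfl | hn
  · exact ⟨1, fun M => Subtype.ext (Subsingleton.elim _ _)⟩
  let o : Fin n := ⟨0, hn⟩
  let k : Fin n := ⟨n - 1, by omega⟩
  have ho : ∀ i, b o ≤ b i := fun i => hb (Fin.mk_le_of_le_val (Nat.zero_le _))
  have hk : ∀ i, b i ≤ b k := fun i => hb (Fin.le_def.2 (by have := i.2; simp only [k]; omega))
  let C : (Fin n → F) →ₗ[F] UTB F b :=
    { toFun := fun w => ⟨Matrix.vecMulVec w (Pi.single k 1), fun i j hij => by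
        have hj : j ≠ k := by
          rintro rfl
          exact absurd hij (not_lt.2 (hk i))
        simp [Matrix.vecMulVec_apply, hj]⟩
      map_add' := fun v w => Subtype.ext (Matrix.add_vecMulVec _ _ _)
      map_smul' := fun c w => Subtype.ext (Matrix.smul_vecMulVec _ _ _) }
  have hC : ∀ (M : UTB F b) w, C (M.1 *ᵥ w) = M * C w := fun M w =>
    Subtype.ext (Matrix.mul_vecMulVec _ _ _).symm
  obtain ⟨v, hv⟩ : ∃ v, (ψ (C (Pi.single o 1))).1 *ᵥ v ≠ 0 := by
    by_contra! h
    have h0 : (ψ (C (Pi.single o 1))).1 = 0 := by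
      ext i j
      have := congrFun (h (Pi.single j 1)) i
      simpa using this
    have h1 : C (Pi.single o 1) = 0 := (map_eq_zero_iff ψ ψ.injective).1 (Subtype.ext h0)
    have h2 : (C (Pi.single o 1)).1 o k = 0 := by rw [h1]; rfl
    simp [C, Matrix.vecMulVec_apply] at h2
  let L : (Fin n → F) →ₗ[F] (Fin n → F) :=
    { toFun := fun w => (ψ (C w)).1 *ᵥ v
      map_add' := fun w w' => by simp [Matrix.add_mulVec]
      map_smul' := fun c w => by simp [Matrix.smul_mulVec] }
  have hL : ∀ (M : UTB F b) w, L (M.1 *ᵥ w) = (ψ M).1 *ᵥ L w := fun M w => by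
    simp only [L, LinearMap.coe_mk, AddHom.coe_mk, hC, map_mul, MulMemClass.coe_mul,
      Matrix.mulVec_mulVec]
  have hinj : Function.Injective L := by
    rw [← LinearMap.ker_eq_bot, LinearMap.ker_eq_bot']
    intro w hw
    ext i
    by_contra hi
    refine hv ?_
    have h1 := hL (UTB.single b (ho i) (w i)⁻¹) w
    have h2 : (UTB.single b (ho i) (w i)⁻¹).1 *ᵥ w = Pi.single o 1 := by
      have : w i ≠ 0 := hi
      simp [UTB.single, Matrix.single_mulVec, this]
      rfl
    rw [hw, Matrix.mulVec_zero, h2] at h1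
    exact h1
  let T := LinearMap.toMatrix' L
  have hTL : ∀ w, T *ᵥ w = L w := fun w => LinearMap.toMatrix'_mulVec L w
  have hTu : IsUnit T := Matrix.mulVec_injective_iff_isUnit.1 (by
    intro w w' h
    exact hinj (by simpa [hTL] using h))
  have hT : ∀ M : UTB F b, T * M.1 = (ψ M).1 * T := fun M =>
    Matrix.ext_of_mulVec_single fun i => by
      rw [← Matrix.mulVec_mulVec, ← Matrix.mulVec_mulVec, hTL, hTL, hL]
  have hTd : IsUnit T.det := (Matrix.isUnit_iff_isUnit_det T).1 hTu
  have hTb := blockTriangular_of_intertwines b hT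
  have := hTu.invertible
  let y : (UTB F b)ˣ := ⟨⟨T, hTb⟩, ⟨T⁻¹, Matrix.blockTriangular_inv_of_blockTriangular hTb⟩,
    Subtype.ext (Matrix.mul_nonsing_inv T hTd), Subtype.ext (Matrix.nonsing_inv_mul T hTd)⟩
  exact ⟨y, fun M => (Units.eq_mul_inv_iff_mul_eq y).2 (Subtype.ext (hT M).symm)⟩

end Inner

theorem stmt4 {F : Type*} [Field F] {G : Type*} [CommGroup G] {n s : ℕ}
    (nn : Fin s → ℕ) (hpos : ∀ i, 0 < nn i) (hn : n = ∑ i, nn i)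
    (b : Fin n → Fin s) (hb : Monotone b)
    (hcard : ∀ i, (Finset.univ.filter fun k => b k = i).card = nn i)
    (Γ₁ Γ₂ : AlgGrading F (↥(UTB F b)) G)
    (hc₁ : ∀ m : ℕ, m < s → Γ₁.IsGradedSubspace (JdiagU F b m))
    (hc₂ : ∀ m : ℕ, m < s → Γ₂.IsGradedSubspace (JdiagU F b m))
    (hiso : AlgGrading.Iso Γ₁ Γ₂) :
    ∃ x : (↥(UTB F b))ˣ,
      ((x : ↥(UTB F b)) : Matrix (Fin n) (Fin n) F) ∈ Jdiag F b 0 ∧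
      ∀ g : G, (Γ₁.comp g).map (conjMap x) = Γ₂.comp g := by
  obtain ⟨ψ, hψ⟩ := hiso
  obtain ⟨y, hy⟩ := UTB.exists_conj b hb ψ
  refine ⟨blockDiagUnit b y, blockPart_mem b 0 _, fun g => le_antisymm ?_ fun c hc => ?_⟩
  · rintro _ ⟨a, ha, rfl⟩
    refine blockDiagUnit_conj_mem b hc₁ hc₂ (fun a ha => ?_) ha
    rw [← hy, ← hψ g]
    exact ⟨a, ha, rfl⟩
  · have hmem := blockDiagUnit_conj_mem b hc₂ hc₁ (y := y⁻¹) (g := g) (fun c hc => ?_) hc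
    · refine ⟨_, hmem, ?_⟩
      change ↑(blockDiagUnit b y) * (↑(blockDiagUnit b y)⁻¹ * c * ↑(blockDiagUnit b y)) *
        ↑(blockDiagUnit b y)⁻¹ = c
      simp [mul_assoc]
    · rw [← hψ g] at hc
      obtain ⟨a, ha, rfl⟩ := hc
      have : ψ.toLinearMap a = ↑y * a * ↑y⁻¹ := hy a
      rw [this]
      simpa [mul_assoc] using ha
end

section
/- Let F be a field, G an abelian group, and U = UT(n_1,…,n_s) ⊆ M_n(F). If two admissible (Z×G)-gradings on M_n(F) induce isomorphic G-gradings on U (by restricting to U and coarsening along the projection Z×G → G), then the two (Z×G)-gradings on M_n(F) are isomorphic. -/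
open Matrix
set_option synthInstance.maxHeartbeats 1000000
set_option maxHeartbeats 1000000

variable (F : Type*) [Field F] {n s : ℕ}

/-- A `(ℤ×G)`-grading on `M_n(F)` is admissible if each `J_m`, `m ≥ 0`, is contained in the
degree-`m` component of the coarsening induced by the projection `ℤ×G → ℤ`. -/
def Admissible {F : Type*} [Field F] {G : Type*} [CommGroup G] {n s : ℕ}
    (b : Fin n → Fin s)
    (Γ : AlgGrading F (Matrix (Fin n) (Fin n) F) (Multiplicative ℤ × G)) : Prop :=
  ∀ m : ℤ, 0 ≤ m → Jdiag F b m ≤ ⨆ g : G, Γ.comp (Multiplicative.ofAdd m, g)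

/-- The degree-`g` component of the `G`-grading induced on `U` by a `(ℤ×G)`-grading on
`M_n(F)`: restrict to `U` and coarsen along the projection `ℤ×G → G`. -/
def inducedComp {F : Type*} [Field F] {G : Type*} [CommGroup G] {n s : ℕ}
    (b : Fin n → Fin s)
    (Γ : AlgGrading F (Matrix (Fin n) (Fin n) F) (Multiplicative ℤ × G)) (g : G) :
    Submodule F ↥(UTB F b) :=
  (⨆ m : ℤ, Γ.comp (Multiplicative.ofAdd m, g)).comap (UTB F b).val.toLinearMap

section Projections

variable {F : Type*} [Field F] {A : Type*} [Ring A] [Algebra F A] {G : Type*} [Group G]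

theorem AlgGrading.induction_on (Γ : AlgGrading F A G) {p : A → Prop}
    (hom : ∀ g, ∀ x ∈ Γ.comp g, p x) (zero : p 0) (add : ∀ x y, p x → p y → p (x + y)) (x : A) :
    p x :=
  Submodule.iSup_induction Γ.comp (x := x) (by rw [Γ.total]; trivial) hom zero add

theorem AlgGrading.exists_proj (Γ : AlgGrading F A G) :
    ∃ π : G → A →ₗ[F] A, (∀ g, ∀ x ∈ Γ.comp g, π g x = x) ∧
      (∀ g h, h ≠ g → ∀ x ∈ Γ.comp h, π g x = 0) ∧
      ∀ g x, (∀ h, h ≠ g → π h x = 0) → x ∈ Γ.comp g := by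
  classical
  have hint : DirectSum.IsInternal Γ.comp :=
    DirectSum.isInternal_submodule_of_iSupIndep_of_iSup_eq_top Γ.indep Γ.total
  let _ := hint.chooseDecomposition
  refine ⟨fun g => (Γ.comp g).subtype ∘ₗ DirectSum.component F G (fun g => Γ.comp g) g ∘ₗ
    (DirectSum.decomposeLinearEquiv Γ.comp).toLinearMap, ?_, ?_, ?_⟩
  · exact fun g x hx => DirectSum.decompose_of_mem_same Γ.comp hx
  · exact fun g h hne x hx => DirectSum.decompose_of_mem_ne Γ.comp hx hne
  · intro g x hx
    rw [← DirectSum.sum_support_decompose Γ.comp x]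
    refine Submodule.sum_mem _ fun h _ => ?_
    by_cases hg : h = g
    · subst hg
      exact SetLike.coe_mem _
    · have h0 : ((DirectSum.decompose Γ.comp x h : Γ.comp h) : A) = 0 := hx h hg
      rw [h0]
      exact zero_mem _

theorem AlgGrading.comp_eq_of_le {Γ Γ' : AlgGrading F A G} (h : ∀ g, Γ.comp g ≤ Γ'.comp g)
    (g : G) : Γ.comp g = Γ'.comp g := by
  refine le_antisymm (h g) fun x hx => ?_
  obtain ⟨π, hπ, hπ0, hmem⟩ := Γ.exists_proj
  obtain ⟨π', hπ', hπ0', -⟩ := Γ'.exists_proj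
  have heq : ∀ k y, π k y = π' k y := fun k y => by
    refine Γ.induction_on (p := fun y => π k y = π' k y) ?_ (by simp) ?_ y
    · intro l z hz
      by_cases hl : l = k
      · subst hl
        rw [hπ _ z hz, hπ' _ z (h _ hz)]
      · rw [hπ0 _ _ hl z hz, hπ0' _ _ hl z (h _ hz)]
    · intro y z hy hz
      simp [hy, hz]
  exact hmem g x fun k hk => by rw [heq, hπ0' _ _ hk.symm x hx]

/-- The image of a grading under an algebra automorphism. -/
def AlgGrading.map (Γ : AlgGrading F A G) (ψ : A ≃ₐ[F] A) : AlgGrading F A G where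
  comp g := (Γ.comp g).map ψ.toLinearMap
  indep := iSupIndep.map_orderIso (Submodule.orderIsoMapComap ψ.toLinearEquiv)
    (show iSupIndep Γ.comp from Γ.indep)
  total := by
    rw [← Submodule.map_iSup, Γ.total, Submodule.map_top]
    exact LinearMap.range_eq_top.2 ψ.surjective
  mul_mem := by
    rintro g h _ ⟨x, hx, rfl⟩ _ ⟨y, hy, rfl⟩
    exact ⟨x * y, Γ.mul_mem g h x hx y hy, map_mul ψ x y⟩

theorem AlgGrading.Iso.of_map_le {Γ Γ' : AlgGrading F A G} (ψ : A ≃ₐ[F] A)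
    (h : ∀ g, ∀ x ∈ Γ.comp g, ψ x ∈ Γ'.comp g) : Γ.Iso Γ' :=
  ⟨ψ, AlgGrading.comp_eq_of_le (Γ := Γ.map ψ) fun g => by
    rintro _ ⟨x, hx, rfl⟩
    exact h g x hx⟩

theorem exists_algEquiv_conj {D E : A} (hDE : D * E = 1) (hED : E * D = 1) :
    ∃ ψ : A ≃ₐ[F] A, ∀ x, ψ x = D * x * E := by
  have key : ∀ {D E : A}, E * D = 1 → D * E = 1 → ∃ f : A →ₐ[F] A, ∀ x, f x = D * x * E :=
    fun {D E} hED hDE => by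
    refine ⟨AlgHom.ofLinearMap (LinearMap.mulRight F E ∘ₗ LinearMap.mulLeft F D) ?_ ?_, ?_⟩
    · simp [hDE]
    · intro x y
      simp only [LinearMap.comp_apply, LinearMap.mulLeft_apply, LinearMap.mulRight_apply]
      calc D * (x * y) * E = D * x * 1 * y * E := by noncomm_ring
        _ = D * x * E * (D * y * E) := by rw [← hED]; noncomm_ring
    · intro x
      simp
  obtain ⟨f, hf⟩ := key hED hDE
  obtain ⟨f', hf'⟩ := key hDE hED
  refine ⟨AlgEquiv.ofAlgHom f f' ?_ ?_, hf⟩ <;> ext x <;> simp only [AlgHom.comp_apply, hf, hf',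
    AlgHom.id_apply]
  · calc D * (E * x * D) * E = (D * E) * x * (D * E) := by noncomm_ring
      _ = x := by simp [hDE]
  · calc E * (D * x * E) * D = (E * D) * x * (E * D) := by noncomm_ring
      _ = x := by simp [hED]

end Projections

section Blocks

variable {F : Type*} [Field F] {n s : ℕ} {b : Fin n → Fin s}

theorem single_mem_Jdiag (p q : Fin n) {m : ℤ} (h : (b q : ℤ) = b p + m) (c : F) :
    Matrix.single p q c ∈ Jdiag F b m := by
  intro p' q' hne
  rw [Matrix.single_apply, if_neg]
  rintro ⟨rfl, rfl⟩
  exact hne h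

theorem Jdiag_le_UTB {m : ℤ} (hm : 0 ≤ m) {x : Matrix (Fin n) (Fin n) F} (hx : x ∈ Jdiag F b m) :
    x ∈ UTB F b := by
  intro p q hpq
  refine hx p q ?_
  have : (b q : ℕ) < b p := hpq
  omega

/-- The projection of a matrix onto its `m`-th block diagonal. -/
def blockDiagPart (F : Type*) [Field F] {n s : ℕ} (b : Fin n → Fin s) (m : ℤ) :
    Matrix (Fin n) (Fin n) F →ₗ[F] Matrix (Fin n) (Fin n) F where
  toFun x := Matrix.of fun p q => if (b q : ℤ) = b p + m then x p q else 0
  map_add' x y := by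
    ext p q
    by_cases h : (b q : ℤ) = b p + m <;> simp [h]
  map_smul' c x := by
    ext p q
    by_cases h : (b q : ℤ) = b p + m <;> simp [h]

theorem blockDiagPart_apply (m : ℤ) (x : Matrix (Fin n) (Fin n) F) (p q : Fin n) :
    blockDiagPart F b m x p q = if (b q : ℤ) = b p + m then x p q else 0 := rfl

theorem blockDiagPart_mem (m : ℤ) (x : Matrix (Fin n) (Fin n) F) :
    blockDiagPart F b m x ∈ Jdiag F b m := fun p q h => by
  rw [blockDiagPart_apply, if_neg h]

theorem blockDiagPart_of_mem {m : ℤ} {x : Matrix (Fin n) (Fin n) F} (hx : x ∈ Jdiag F b m) :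
    blockDiagPart F b m x = x := by
  ext p q
  rw [blockDiagPart_apply]
  split_ifs with h
  · rfl
  · exact (hx p q h).symm

theorem blockDiagPart_of_mem_ne {m k : ℤ} (hne : m ≠ k) {x : Matrix (Fin n) (Fin n) F}
    (hx : x ∈ Jdiag F b m) : blockDiagPart F b k x = 0 := by
  ext p q
  rw [blockDiagPart_apply]
  split_ifs with h
  · exact hx p q (by omega)
  · rfl

theorem mul_mem_Jdiag {k m : ℤ} {x y : Matrix (Fin n) (Fin n) F} (hx : x ∈ Jdiag F b k)
    (hy : y ∈ Jdiag F b m) : x * y ∈ Jdiag F b (k + m) := by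
  intro p q h
  rw [Matrix.mul_apply]
  refine Finset.sum_eq_zero fun r _ => ?_
  by_cases hr : (b r : ℤ) = b p + k
  · rw [hy r q (by omega), mul_zero]
  · rw [hx p r hr, zero_mul]

theorem blockDiagPart_mul_left {P x : Matrix (Fin n) (Fin n) F} {m : ℤ} (hP : P ∈ UTB F b)
    (hx : ∀ p q, (b q : ℤ) < b p + m → x p q = 0) :
    blockDiagPart F b m (P * x) = blockDiagPart F b 0 P * blockDiagPart F b m x := by
  ext p q
  rw [blockDiagPart_apply]
  split_ifs with h
  · simp only [Matrix.mul_apply, blockDiagPart_apply]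
    refine Finset.sum_congr rfl fun r _ => ?_
    rcases lt_trichotomy (b r : ℕ) (b p) with hr | hr | hr
    · rw [hP hr, if_neg (by omega), zero_mul, zero_mul]
    · rw [if_pos (by omega), if_pos (by omega)]
    · rw [hx r q (by omega), if_neg (by omega), zero_mul, mul_zero]
  · have := mul_mem_Jdiag (blockDiagPart_mem (b := b) 0 P) (blockDiagPart_mem (b := b) m x) p q
    rw [this (by omega)]

theorem blockDiagPart_mul_right {x Q : Matrix (Fin n) (Fin n) F} {m : ℤ}
    (hx : x ∈ Jdiag F b m) :
    blockDiagPart F b m (x * Q) = x * blockDiagPart F b 0 Q := by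
  ext p q
  rw [blockDiagPart_apply]
  split_ifs with h
  · simp only [Matrix.mul_apply, blockDiagPart_apply]
    refine Finset.sum_congr rfl fun r _ => ?_
    by_cases hr : (b r : ℤ) = b p + m
    · rw [if_pos (by omega)]
    · rw [hx p r hr, zero_mul, zero_mul]
  · have := mul_mem_Jdiag hx (blockDiagPart_mem (b := b) 0 Q) p q
    rw [this (by omega)]

theorem blockDiagPart_conj {P x Q : Matrix (Fin n) (Fin n) F} {m : ℤ} (hP : P ∈ UTB F b)
    (hQ : Q ∈ UTB F b) (hx : x ∈ Jdiag F b m) :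
    blockDiagPart F b m (P * x * Q) = blockDiagPart F b 0 P * x * blockDiagPart F b 0 Q := by
  rw [mul_assoc, blockDiagPart_mul_left hP, blockDiagPart_mul_right hx, mul_assoc]
  intro p q hpq
  rw [Matrix.mul_apply]
  refine Finset.sum_eq_zero fun r _ => ?_
  by_cases hr : (b r : ℤ) = b p + m
  · rw [hQ (show (b q : ℕ) < b r by omega), mul_zero]
  · rw [hx p r hr, zero_mul]

theorem one_mem_Jdiag : (1 : Matrix (Fin n) (Fin n) F) ∈ Jdiag F b 0 := by
  intro p q h
  refine Matrix.one_apply_ne ?_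
  rintro rfl
  exact h (by simp)

theorem blockDiagPart_mul_eq_one {P Q : Matrix (Fin n) (Fin n) F} (hP : P ∈ UTB F b)
    (hQ : Q ∈ UTB F b) (h : P * Q = 1) : blockDiagPart F b 0 P * blockDiagPart F b 0 Q = 1 := by
  have := blockDiagPart_conj hP hQ (one_mem_Jdiag (F := F) (b := b))
  rw [mul_one, mul_one, h, blockDiagPart_of_mem one_mem_Jdiag] at this
  exact this.symm

/-- The vectors supported on the blocks up to the `i`-th one. -/
def flagSubmodule (F : Type*) [Field F] {n s : ℕ} (b : Fin n → Fin s) (i : Fin s) :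
    Submodule F (Fin n → F) where
  carrier := {v | ∀ k, i < b k → v k = 0}
  add_mem' hv hw k hk := by simp [hv k hk, hw k hk]
  zero_mem' _ _ := rfl
  smul_mem' c v hv k hk := by simp [hv k hk]

theorem mulVec_mem_flagSubmodule {x : Matrix (Fin n) (Fin n) F} (hx : x ∈ UTB F b) {i : Fin s}
    {v : Fin n → F} (hv : v ∈ flagSubmodule F b i) : x *ᵥ v ∈ flagSubmodule F b i := by
  intro k hk
  change ∑ j, x k j * v j = 0
  refine Finset.sum_eq_zero fun j _ => ?_
  rcases lt_or_ge i (b j) with h | h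
  · simp [hv j h]
  · rw [hx (lt_of_le_of_lt h hk), zero_mul]

theorem single_mem_UTB {p q : Fin n} (h : b p ≤ b q) (c : F) : Matrix.single p q c ∈ UTB F b :=
  Jdiag_le_UTB (m := (b q : ℤ) - b p) (by have : (b p : ℕ) ≤ b q := h; omega)
    (single_mem_Jdiag p q (by ring) c)

theorem mem_UTB_of_intertwining (ψ : UTB F b ≃ₐ[F] UTB F b) {P : Matrix (Fin n) (Fin n) F}
    (hP : ∀ x : UTB F b, (ψ x : Matrix (Fin n) (Fin n) F) * P = P * x) : P ∈ UTB F b := by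
  intro i j hij
  by_contra hne
  have hle : flagSubmodule F b (b i) ≤ (flagSubmodule F b (b j)).map P.mulVecLin := by
    intro v hv
    let c : Matrix (Fin n) (Fin n) F := Matrix.vecMulVec v (Pi.single i (P i j)⁻¹)
    have hc : c ∈ UTB F b := by
      intro p q hpq
      change v p * (Pi.single i (P i j)⁻¹ : Fin n → F) q = 0
      by_cases hq : q = i
      · subst hq
        rw [hv p hpq, zero_mul]
      · rw [Pi.single_eq_of_ne hq, mul_zero]
    obtain ⟨x, hx⟩ := ψ.surjective ⟨c, hc⟩
    refine ⟨(x : Matrix (Fin n) (Fin n) F) *ᵥ Pi.single j 1, ?_, ?_⟩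
    · refine mulVec_mem_flagSubmodule x.2 fun k hk => Pi.single_eq_of_ne ?_ _
      rintro rfl
      exact lt_irrefl _ hk
    · have hPx := hP x
      rw [hx] at hPx
      rw [Matrix.mulVecLin_apply, Matrix.mulVec_mulVec, ← hPx, ← Matrix.mulVec_mulVec]
      ext k
      simp [c, Matrix.vecMulVec_mulVec, hne]
  have hlt : flagSubmodule F b (b j) < flagSubmodule F b (b i) := by
    refine lt_of_le_of_ne (fun v hv k hk => hv k (hij.trans hk)) fun heq => ?_
    have hmem : (Pi.single i 1 : Fin n → F) ∈ flagSubmodule F b (b i) := fun k hk =>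
      Pi.single_eq_of_ne (by rintro rfl; exact lt_irrefl _ hk) _
    rw [← heq] at hmem
    simpa using hmem i hij
  exact absurd ((Submodule.finrank_mono hle).trans (Submodule.finrank_map_le _ _))
    (not_le.2 (Submodule.finrank_lt_finrank_of_lt hlt))

theorem exists_isUnit_intertwining (ψ : UTB F b ≃ₐ[F] UTB F b) :
    ∃ P : Matrix (Fin n) (Fin n) F, IsUnit P ∧
      ∀ x : UTB F b, (ψ x : Matrix (Fin n) (Fin n) F) * P = P * x := by
  rcases isEmpty_or_nonempty (Fin n) with hn | hn
  · exact ⟨1, isUnit_one, fun x => Subsingleton.elim _ _⟩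
  obtain ⟨l, hl⟩ := Finite.exists_max b
  obtain ⟨o, ho⟩ := Finite.exists_min b
  let col : (Fin n → F) →ₗ[F] UTB F b :=
    { toFun := fun v => ⟨Matrix.vecMulVec v (Pi.single l 1), fun p q hpq => by
        rw [Matrix.vecMulVec_apply, Pi.single_eq_of_ne, mul_zero]
        rintro rfl
        exact not_le.2 hpq (hl p)⟩
      map_add' := fun v w => Subtype.ext (Matrix.add_vecMulVec _ _ _)
      map_smul' := fun c v => Subtype.ext (Matrix.smul_vecMulVec _ _ _) }
  have hcol : ∀ (x : UTB F b) v, col ((x : Matrix (Fin n) (Fin n) F) *ᵥ v) = x * col v :=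
    fun x v => Subtype.ext (Matrix.mul_vecMulVec _ _ _).symm
  have hinj : Function.Injective col := fun v w h => by
    ext k
    have := congrFun (congrFun (congrArg Subtype.val h) k) l
    simpa [col, Matrix.vecMulVec_apply] using this
  obtain ⟨w, hw⟩ : ∃ w, (ψ (col (Pi.single o 1)) : Matrix (Fin n) (Fin n) F) *ᵥ w ≠ 0 := by
    by_contra! h
    have h0 : ψ (col (Pi.single o 1)) = 0 :=
      Subtype.ext (Matrix.ext_of_mulVec_single fun i => by
        rw [h]
        exact (Matrix.zero_mulVec _).symm)
    rw [map_eq_zero_iff _ ψ.injective, map_eq_zero_iff _ hinj] at h0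
    simpa using congrFun h0 o
  let f : (Fin n → F) →ₗ[F] (Fin n → F) :=
    LinearMap.flip (Matrix.mulVecBilin F F) w ∘ₗ (UTB F b).val.toLinearMap ∘ₗ ψ.toLinearMap ∘ₗ col
  have hf : ∀ v, f v = (ψ (col v) : Matrix (Fin n) (Fin n) F) *ᵥ w := fun v => rfl
  have hmul : ∀ (x : UTB F b) v, f ((x : Matrix (Fin n) (Fin n) F) *ᵥ v) =
      (ψ x : Matrix (Fin n) (Fin n) F) *ᵥ f v := fun x v => by
    rw [hf, hf, hcol, map_mul, Matrix.mulVec_mulVec]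
    rfl
  have hker : Function.Injective f := by
    refine (injective_iff_map_eq_zero f).2 fun v hv => ?_
    ext k
    by_contra hk
    refine hw ?_
    rw [← hf]
    have := hmul ⟨Matrix.single o k (v k)⁻¹, single_mem_UTB (ho k) _⟩ v
    rw [hv, Matrix.mulVec_zero] at this
    rw [← this]
    congr 1
    ext i
    have hk' : v k ≠ 0 := hk
    by_cases hi : i = o
    · subst hi
      simp [Matrix.single_mulVec, hk']
    · simp [Matrix.single_mulVec, hi]
  refine ⟨LinearMap.toMatrix' f, ?_, fun x => ?_⟩
  · rw [← Matrix.mulVec_injective_iff_isUnit]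
    intro v w h
    simp only [LinearMap.toMatrix'_mulVec] at h
    exact hker h
  · refine Matrix.ext_of_mulVec_single fun i => ?_
    rw [← Matrix.mulVec_mulVec, ← Matrix.mulVec_mulVec, LinearMap.toMatrix'_mulVec,
      LinearMap.toMatrix'_mulVec, hmul]

/-- Every automorphism of the algebra of block-triangular matrices is inner. -/
theorem UTB.exists_conj_s5 (ψ : UTB F b ≃ₐ[F] UTB F b) :
    ∃ P ∈ UTB F b, ∃ Q ∈ UTB F b, P * Q = 1 ∧ Q * P = 1 ∧
      ∀ x : UTB F b, (ψ x : Matrix (Fin n) (Fin n) F) = P * x * Q := by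
  obtain ⟨P, hu, hP⟩ := exists_isUnit_intertwining ψ
  have hPU := mem_UTB_of_intertwining ψ hP
  have hdet := (Matrix.isUnit_iff_isUnit_det P).1 hu
  let _ := hu.invertible
  refine ⟨P, hPU, P⁻¹, Matrix.blockTriangular_inv_of_blockTriangular hPU,
    P.mul_nonsing_inv hdet, P.nonsing_inv_mul hdet, fun x => ?_⟩
  rw [← hP, mul_assoc, P.mul_nonsing_inv hdet, mul_one]

end Blocks

section Admissible

variable {F : Type*} [Field F] {G : Type*} [CommGroup G] {n s : ℕ} {b : Fin n → Fin s}
  {Γ : AlgGrading F (Matrix (Fin n) (Fin n) F) (Multiplicative ℤ × G)}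

theorem AlgGrading.coarse_mul_mem {k m : ℤ} {x y : Matrix (Fin n) (Fin n) F}
    (hx : x ∈ ⨆ g : G, Γ.comp (Multiplicative.ofAdd k, g))
    (hy : y ∈ ⨆ g : G, Γ.comp (Multiplicative.ofAdd m, g)) :
    x * y ∈ ⨆ g : G, Γ.comp (Multiplicative.ofAdd (k + m), g) := by
  refine Submodule.iSup_induction _ (motive := fun x => x * y ∈ _) hx ?_ (by simp) ?_
  · intro g x hx
    refine Submodule.iSup_induction _ (motive := fun y => x * y ∈ _) hy ?_ (by simp) ?_
    · intro h y hy
      exact Submodule.mem_iSup_of_mem (g * h) (Γ.mul_mem _ _ x hx y hy)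
    · intro y z hy hz
      rw [mul_add]
      exact add_mem hy hz
  · intro x z hx hz
    rw [add_mul]
    exact add_mem hx hz

theorem AlgGrading.coarse_degree_eq {k m : ℤ} {x : Matrix (Fin n) (Fin n) F}
    (hk : x ∈ ⨆ g : G, Γ.comp (Multiplicative.ofAdd k, g))
    (hm : x ∈ ⨆ g : G, Γ.comp (Multiplicative.ofAdd m, g)) (hx : x ≠ 0) : k = m := by
  by_contra hne
  obtain ⟨π, -, hπ0, hmem⟩ := Γ.exists_proj
  have hvan : ∀ {k : ℤ} {x}, x ∈ (⨆ g : G, Γ.comp (Multiplicative.ofAdd k, g)) →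
      ∀ d : Multiplicative ℤ × G, d.1 ≠ Multiplicative.ofAdd k → π d x = 0 := by
    intro k x hx d hd
    refine Submodule.iSup_induction _ (motive := fun x => π d x = 0) hx ?_ (by simp) ?_
    · intro g y hy
      exact hπ0 _ _ (fun h => hd (by rw [← h])) y hy
    · intro y z hy hz
      simp [hy, hz]
  have hall : ∀ d, π d x = 0 := fun d => by
    by_cases hd : d.1 = Multiplicative.ofAdd k
    · exact hvan hm d fun h => hne (Multiplicative.ofAdd.injective (hd.symm.trans h))
    · exact hvan hk d hd
  have h1 := hmem (Multiplicative.ofAdd k, 1) x fun d _ => hall d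
  have h2 := hmem (Multiplicative.ofAdd m, 1) x fun d _ => hall d
  exact hx (Submodule.disjoint_def.1 (Γ.indep (Multiplicative.ofAdd k, 1)) x h1
    (Submodule.mem_iSup_of_mem (Multiplicative.ofAdd m, 1) (Submodule.mem_iSup_of_mem
      (fun h => hne (Multiplicative.ofAdd.injective (congrArg Prod.fst h)).symm) h2)))

theorem Admissible.comp_le_Jdiag (h : Admissible b Γ) (d : Multiplicative ℤ × G) :
    Γ.comp d ≤ Jdiag F b d.1.toAdd := by
  intro y hy p q hne
  by_contra hpq
  have hdiag : ∀ r : Fin n, (Matrix.single r r 1 : Matrix (Fin n) (Fin n) F) ∈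
      ⨆ g : G, Γ.comp (Multiplicative.ofAdd 0, g) := fun r =>
    h 0 le_rfl (single_mem_Jdiag r r (by ring) 1)
  have hyc : y ∈ ⨆ g : G, Γ.comp (Multiplicative.ofAdd d.1.toAdd, g) :=
    Submodule.mem_iSup_of_mem d.2 hy
  have hunit := AlgGrading.coarse_mul_mem (AlgGrading.coarse_mul_mem (hdiag p) hyc) (hdiag q)
  rw [Matrix.single_mul_mul_single, one_mul, mul_one, zero_add, add_zero] at hunit
  rcases le_total (b p : ℤ) (b q) with hle | hle
  · have := AlgGrading.coarse_degree_eq hunit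
      (h ((b q : ℤ) - b p) (by omega) (single_mem_Jdiag p q (by ring) (y p q)))
      fun h0 => hpq (by simpa using congrFun (congrFun h0 p) q)
    omega
  · have hmul := AlgGrading.coarse_mul_mem
      (h ((b p : ℤ) - b q) (by omega) (single_mem_Jdiag q p (by ring) (1 : F))) hunit
    rw [Matrix.single_mul_single_same, one_mul] at hmul
    have := AlgGrading.coarse_degree_eq hmul
      (h 0 le_rfl (single_mem_Jdiag q q (by ring) (y p q)))
      fun h0 => hpq (by simpa using congrFun (congrFun h0 q) q)
    omega

theorem Admissible.Jdiag_le (h : Admissible b Γ) (m : ℤ) :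
    Jdiag F b m ≤ ⨆ g : G, Γ.comp (Multiplicative.ofAdd m, g) := by
  intro x hx
  rw [← blockDiagPart_of_mem hx]
  refine Γ.induction_on (p := fun x => blockDiagPart F b m x ∈ _) ?_ (by simp) ?_ x
  · rintro ⟨a, g⟩ y hy
    have hyJ := h.comp_le_Jdiag _ hy
    by_cases ha : a.toAdd = m
    · subst ha
      rw [blockDiagPart_of_mem hyJ]
      exact Submodule.mem_iSup_of_mem g hy
    · rw [blockDiagPart_of_mem_ne ha hyJ]
      exact zero_mem _
  · intro y z hy hz
    rw [map_add]
    exact add_mem hy hz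

theorem Admissible.blockDiagPart_mem_comp (h : Admissible b Γ) {g : G}
    {x : Matrix (Fin n) (Fin n) F} (hx : x ∈ ⨆ m : ℤ, Γ.comp (Multiplicative.ofAdd m, g))
    (m : ℤ) : blockDiagPart F b m x ∈ Γ.comp (Multiplicative.ofAdd m, g) := by
  refine Submodule.iSup_induction _ (motive := fun x => blockDiagPart F b m x ∈ _) hx ?_
    (by simp) ?_
  · intro a y hy
    have hyJ : y ∈ Jdiag F b a := h.comp_le_Jdiag _ hy
    by_cases ha : a = m
    · subst ha
      rwa [blockDiagPart_of_mem hyJ]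
    · rw [blockDiagPart_of_mem_ne ha hyJ]
      exact zero_mem _
  · intro y z hy hz
    rw [map_add]
    exact add_mem hy hz

/-- An inner automorphism by a block-diagonal matrix that respects the components of
nonnegative `ℤ`-degree of two admissible gradings respects all their components. -/
theorem Admissible.conj_mem_comp {Γ' : AlgGrading F (Matrix (Fin n) (Fin n) F)
    (Multiplicative ℤ × G)} (h : Admissible b Γ) (h' : Admissible b Γ')
    {D E : Matrix (Fin n) (Fin n) F} (hD : D ∈ Jdiag F b 0) (hE : E ∈ Jdiag F b 0)
    (hDE : D * E = 1) (hED : E * D = 1)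
    (hpos : ∀ m : ℤ, 0 ≤ m → ∀ g : G, ∀ x ∈ Γ.comp (Multiplicative.ofAdd m, g),
      D * x * E ∈ Γ'.comp (Multiplicative.ofAdd m, g))
    (m : ℤ) (g : G) {x : Matrix (Fin n) (Fin n) F}
    (hx : x ∈ Γ.comp (Multiplicative.ofAdd m, g)) :
    D * x * E ∈ Γ'.comp (Multiplicative.ofAdd m, g) := by
  rcases le_total 0 m with hm | hm
  · exact hpos m hm g x hx
  have hxJ : x ∈ Jdiag F b m := h.comp_le_Jdiag _ hx
  have hy : D * x * E ∈ Jdiag F b m := by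
    simpa using mul_mem_Jdiag (mul_mem_Jdiag hD hxJ) hE
  obtain ⟨π, hπ, hπ0, hmem⟩ := Γ'.exists_proj
  have hπmem : ∀ d y, π d y ∈ Γ'.comp d := fun d y => by
    refine Γ'.induction_on (p := fun y => π d y ∈ _) ?_ (by simp) ?_ y
    · intro e z hz
      by_cases he : e = d
      · subst he
        rwa [hπ _ z hz]
      · rw [hπ0 _ _ he z hz]
        exact zero_mem _
    · intro y z hy hz
      rw [map_add]
      exact add_mem hy hz
  have hπmul : ∀ e d u y, u ∈ Γ'.comp e → u * π d y = π (e * d) (u * y) := fun e d u y hu => by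
    refine Γ'.induction_on (p := fun y => u * π d y = π (e * d) (u * y)) ?_ (by simp) ?_ y
    · intro f z hz
      have huz := Γ'.mul_mem _ _ u hu z hz
      by_cases hf : f = d
      · subst hf
        rw [hπ _ z hz, hπ _ _ huz]
      · rw [hπ0 _ _ hf z hz, hπ0 _ _ (fun h => hf (mul_left_cancel h)) _ huz, mul_zero]
    · intro y z hy hz
      rw [map_add, mul_add, mul_add, map_add, hy, hz]
  refine hmem _ _ fun d hd => ?_
  by_cases hdm : d.1 = Multiplicative.ofAdd m
  · set z := π d (D * x * E) with hz
    have hzJ : z ∈ Jdiag F b m := by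
      have := h'.comp_le_Jdiag _ (hπmem d (D * x * E))
      rwa [hdm] at this
    have hann : ∀ u ∈ Jdiag F b (-m), D * u * E * z = 0 := by
      intro u hu
      refine Submodule.iSup_induction _ (motive := fun u => D * u * E * z = 0)
        (h (-m) (by omega) hu) ?_ (by simp) ?_
      · intro c u hu
        have huD := hpos (-m) (by omega) c u hu
        rw [hπmul _ d _ (D * x * E) huD]
        have hprod : D * u * E * (D * x * E) = D * (u * x) * E := by
          calc D * u * E * (D * x * E) = D * u * (E * D) * x * E := by noncomm_ring
            _ = D * (u * x) * E := by rw [hED]; noncomm_ring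
        have hux : u * x ∈ Γ.comp (Multiplicative.ofAdd (-m + m), c * g) :=
          Γ.mul_mem _ _ u hu x hx
        rw [hprod]
        refine hπ0 _ (Multiplicative.ofAdd (-m + m), c * g) ?_ _
          (hpos _ (by omega) _ _ hux)
        intro heq
        exact hd (mul_left_cancel (a := (Multiplicative.ofAdd (-m), c)) heq.symm)
      · intro u v hu hv
        rw [mul_add, add_mul, add_mul, hu, hv, add_zero]
    have hEzD : E * z = 0 := by
      have hEz : E * z ∈ Jdiag F b m := by simpa using mul_mem_Jdiag hE hzJ
      ext q p
      by_cases hqp : (b p : ℤ) = b q + m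
      · have h0 := hann (Matrix.single p q 1) (single_mem_Jdiag p q (by omega) 1)
        have h1 : Matrix.single p q 1 * (E * z) = 0 := by
          calc Matrix.single p q 1 * (E * z) = (E * D) * Matrix.single p q 1 * (E * z) := by
                rw [hED, one_mul]
            _ = E * (D * Matrix.single p q 1 * E * z) := by simp only [mul_assoc]
            _ = 0 := by rw [h0, mul_zero]
        simpa using congrFun (congrFun h1 p) p
      · exact hEz q p hqp
    calc z = D * E * z := by rw [hDE, one_mul]
      _ = 0 := by rw [mul_assoc, hEzD, mul_zero]
  · refine Submodule.iSup_induction _ (motive := fun y => π d y = 0) (h'.Jdiag_le m hy) ?_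
      (by simp) ?_
    · intro c y hy
      exact hπ0 _ _ (fun h => hdm (by rw [← h])) y hy
    · intro y z hy hz
      simp [hy, hz]

end Admissible

theorem stmt5 {F : Type*} [Field F] {G : Type*} [CommGroup G] {n s : ℕ}
    (nn : Fin s → ℕ) (hpos : ∀ i, 0 < nn i) (hn : n = ∑ i, nn i)
    (b : Fin n → Fin s) (hb : Monotone b)
    (hcard : ∀ i, (Finset.univ.filter fun k => b k = i).card = nn i)
    (Γ₁ Γ₂ : AlgGrading F (Matrix (Fin n) (Fin n) F) (Multiplicative ℤ × G))
    (h₁ : Admissible b Γ₁) (h₂ : Admissible b Γ₂)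
    (hind : ∃ ψ : ↥(UTB F b) ≃ₐ[F] ↥(UTB F b),
      ∀ g : G, (inducedComp b Γ₁ g).map ψ.toLinearMap = inducedComp b Γ₂ g) :
    AlgGrading.Iso Γ₁ Γ₂ := by
  obtain ⟨ψ, hψ⟩ := hind
  obtain ⟨P, hP, Q, hQ, hPQ, hQP, hconj⟩ := UTB.exists_conj_s5 ψ
  have hDE := blockDiagPart_mul_eq_one hP hQ hPQ
  have hED := blockDiagPart_mul_eq_one hQ hP hQP
  obtain ⟨φ, hφ⟩ := exists_algEquiv_conj (F := F) hDE hED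
  refine AlgGrading.Iso.of_map_le φ fun d x hx => ?_
  rw [hφ]
  refine h₁.conj_mem_comp h₂ (blockDiagPart_mem 0 P) (blockDiagPart_mem 0 Q) hDE hED ?_
    d.1.toAdd d.2 hx
  intro m hm g x hx
  have hxJ : x ∈ Jdiag F b m := h₁.comp_le_Jdiag _ hx
  rw [← blockDiagPart_conj hP hQ hxJ]
  refine h₂.blockDiagPart_mem_comp ?_ m
  have hxI : (⟨x, Jdiag_le_UTB hm hxJ⟩ : UTB F b) ∈ inducedComp b Γ₁ g :=
    Submodule.mem_iSup_of_mem m hx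
  have hmap : ψ ⟨x, Jdiag_le_UTB hm hxJ⟩ ∈ inducedComp b Γ₂ g :=
    hψ g ▸ Submodule.mem_map_of_mem hxI
  have hval := hconj ⟨x, Jdiag_le_UTB hm hxJ⟩
  rw [← hval]
  exact hmap
end
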